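/- Let F be a field of characteristic 0, let R_ℓ = F[u_i^{(n)} : 1 ≤ i ≤ ℓ, n ∈ ℤ_{≥0}] be the algebra of differential polynomials with derivation ∂ determined by ∂(u_i^{(n)}) = u_i^{(n+1)}, let m ≤ ℓ, and let p_1,…,p_m ∈ R_ℓ depend only on the variables u_i^{(n)} with i ≤ ℓ−m. Define the modified partial derivatives ∂̃/∂̃u_i^{(s)} = ∂/∂u_i^{(s)} − Σ_{α=1}^m Σ_{n≥0} (∂(∂^n p_α)/∂u_i^{(s)}) · ∂/∂u_{ℓ−m+α}^{(n)} for 1 ≤ i ≤ ℓ−m, s ∈ ℤ_{≥0}. Then these satisfy the same commutation relations with ∂ as the ordinary partial derivatives: (∂̃/∂̃u_i^{(s)}) ∘ ∂ − ∂ ∘ (∂̃/∂̃u_i^{(s)}) = ∂̃/∂̃u_i^{(s−1)} for s ≥ 1, and (∂̃/∂̃u_i^{(0)}) ∘ ∂ − ∂ ∘ (∂̃/∂̃u_i^{(0)}) = 0. -/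

import Mathlib

open MvPolynomial

/-- Only finitely many of the partial derivatives of a polynomial along a family of distinct
variables are nonzero. -/
theorem finite_support_mul_pderiv {R σ ι : Type*} [CommRing R] {v : ι → σ}
    (hv : Function.Injective v) (c : ι → MvPolynomial σ R) (f : MvPolynomial σ R) :
    (Function.support fun n => c n * pderiv (v n) f).Finite := by
  classical
  refine (f.vars.finite_toSet.preimage hv.injOn).subset fun n hn => ?_
  by_contra h
  exact hn (by simp [pderiv_eq_zero_of_notMem_vars h])

/-- The derivation `∑ₙ c n * ∂/∂(v n)`, for a family `v` of distinct variables. -/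
noncomputable def finsumPderiv {R σ ι : Type*} [CommRing R] (v : ι → σ)
    (hv : Function.Injective v) (c : ι → MvPolynomial σ R) :
    Derivation R (MvPolynomial σ R) (MvPolynomial σ R) :=
  Derivation.mk'
    { toFun := fun f => ∑ᶠ n, c n * pderiv (v n) f
      map_add' := fun f g => by
        simp only [map_add, mul_add]
        exact finsum_add_distrib (finite_support_mul_pderiv hv c f)
          (finite_support_mul_pderiv hv c g)
      map_smul' := fun r f => by
        simp only [Derivation.map_smul, mul_smul_comm, RingHom.id_apply]
        exact (smul_finsum' r (finite_support_mul_pderiv hv c f)).symm }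
    fun f g => by
      simp only [LinearMap.coe_mk, AddHom.coe_mk, smul_eq_mul]
      rw [mul_finsum' _ _ (finite_support_mul_pderiv hv c g),
        mul_finsum' _ _ (finite_support_mul_pderiv hv c f), ← finsum_add_distrib]
      · refine finsum_congr fun n => ?_
        simp only [Derivation.leibniz, smul_eq_mul]
        ring
      · exact (finite_support_mul_pderiv hv c g).subset fun n hn h => hn (by simp [h])
      · exact (finite_support_mul_pderiv hv c f).subset fun n hn h => hn (by simp [h])

theorem finsumPderiv_apply {R σ ι : Type*} [CommRing R] {v : ι → σ}
    (hv : Function.Injective v) (c : ι → MvPolynomial σ R) (f : MvPolynomial σ R) :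
    finsumPderiv v hv c f = ∑ᶠ n, c n * pderiv (v n) f :=
  rfl

theorem finsumPderiv_X_self {R σ ι : Type*} [CommRing R] {v : ι → σ}
    (hv : Function.Injective v) (c : ι → MvPolynomial σ R) (k : ι) :
    finsumPderiv v hv c (X (v k)) = c k := by
  rw [finsumPderiv_apply, finsum_eq_single _ k]
  · simp
  · intro n hn
    rw [pderiv_X_of_ne (fun h => hn (hv h).symm), mul_zero]

theorem finsumPderiv_X_of_notMem {R σ ι : Type*} [CommRing R] {v : ι → σ}
    (hv : Function.Injective v) (c : ι → MvPolynomial σ R) {w : σ} (hw : ∀ n, v n ≠ w) :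
    finsumPderiv v hv c (X w) = 0 := by
  rw [finsumPderiv_apply, ← finsum_zero (α := ι)]
  refine finsum_congr fun n => ?_
  rw [pderiv_X_of_ne (hw n).symm, mul_zero]

theorem pderiv_succ_total_derivative {R τ : Type*} [CommRing R]
    (D : Derivation R (MvPolynomial (τ × ℕ) R) (MvPolynomial (τ × ℕ) R))
    (hD : ∀ v n, D (X (v, n)) = X (v, n + 1)) (i : τ) (s : ℕ) (f : MvPolynomial (τ × ℕ) R) :
    pderiv (i, s + 1) (D f) = D (pderiv (i, s + 1) f) + pderiv (i, s) f := by
  classical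
  have h : ⁅pderiv (R := R) (i, s + 1), D⁆ = pderiv (i, s) := by
    refine derivation_ext fun ⟨j, n⟩ => ?_
    rw [Derivation.commutator_apply, hD]
    simp only [pderiv_X, Pi.single_apply, Prod.mk.injEq, add_left_inj, apply_ite D,
      Derivation.map_one_eq_zero, map_zero, ite_self, sub_zero]
  rw [← h, Derivation.commutator_apply]
  ring

theorem pderiv_zero_total_derivative {R τ : Type*} [CommRing R]
    (D : Derivation R (MvPolynomial (τ × ℕ) R) (MvPolynomial (τ × ℕ) R))
    (hD : ∀ v n, D (X (v, n)) = X (v, n + 1)) (i : τ) (f : MvPolynomial (τ × ℕ) R) :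
    pderiv (i, 0) (D f) = D (pderiv (i, 0) f) := by
  classical
  have h : ⁅pderiv (R := R) (i, 0), D⁆ = 0 := by
    refine derivation_ext fun ⟨j, n⟩ => ?_
    rw [Derivation.commutator_apply, hD]
    simp [pderiv_X, Pi.single_apply, apply_ite D]
  rw [← sub_eq_zero, ← Derivation.commutator_apply, h, Derivation.zero_apply]

/-- The modified partial derivatives satisfy the same commutation relations
with the total derivative ∂ as the ordinary partial derivatives:
[∂̃/∂̃u_i^{(s)}, ∂] = ∂̃/∂̃u_i^{(s−1)} (and = 0 for s = 0). -/
theorem modified_pderiv_comm_total_derivative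
    {F : Type*} [Field F] [CharZero F] {k m : ℕ}
    (D : Derivation F (MvPolynomial ((Fin k ⊕ Fin m) × ℕ) F)
      (MvPolynomial ((Fin k ⊕ Fin m) × ℕ) F))
    (hD : ∀ (v : Fin k ⊕ Fin m) (n : ℕ), D (X (v, n)) = X (v, n + 1))
    (p : Fin m → MvPolynomial ((Fin k ⊕ Fin m) × ℕ) F)
    (hp : ∀ (α β : Fin m) (n : ℕ), pderiv (Sum.inr β, n) (p α) = 0)
    (Dt : Fin k → ℕ → MvPolynomial ((Fin k ⊕ Fin m) × ℕ) F →
      MvPolynomial ((Fin k ⊕ Fin m) × ℕ) F)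
    (hDt : ∀ i s f, Dt i s f = pderiv (Sum.inl i, s) f
      - ∑ α : Fin m, ∑ᶠ n : ℕ,
          pderiv (Sum.inl i, s) ((⇑D)^[n] (p α)) * pderiv (Sum.inr α, n) f) :
    (∀ i s (f : MvPolynomial ((Fin k ⊕ Fin m) × ℕ) F),
      Dt i (s + 1) (D f) - D (Dt i (s + 1) f) = Dt i s f) ∧
    (∀ i (f : MvPolynomial ((Fin k ⊕ Fin m) × ℕ) F),
      Dt i 0 (D f) - D (Dt i 0 f) = 0) := by
  classical
  have hinj (α : Fin m) :
      Function.Injective fun n : ℕ => ((Sum.inr α, n) : (Fin k ⊕ Fin m) × ℕ) :=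
    fun a b h => congrArg Prod.snd h
  let T (i : Fin k) (s : ℕ) : Derivation F (MvPolynomial ((Fin k ⊕ Fin m) × ℕ) F)
      (MvPolynomial ((Fin k ⊕ Fin m) × ℕ) F) :=
    pderiv (Sum.inl i, s) - ∑ α : Fin m,
      finsumPderiv _ (hinj α) fun n => pderiv (Sum.inl i, s) ((⇑D)^[n] (p α))
  have hT (i s f) : T i s f = pderiv (Sum.inl i, s) f - ∑ α : Fin m,
      finsumPderiv _ (hinj α) (fun n => pderiv (Sum.inl i, s) ((⇑D)^[n] (p α))) f := by
    simp only [T, Derivation.sub_apply, ← Derivation.coeFnAddMonoidHom_apply, map_sum,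
      Finset.sum_apply]
  have hDtT (i s f) : Dt i s f = T i s f := by
    rw [hDt, hT]
    rfl
  have hTinl (i s j n) : T i s (X (Sum.inl j, n)) = if j = i ∧ n = s then 1 else 0 := by
    rw [hT, Finset.sum_eq_zero fun α _ => finsumPderiv_X_of_notMem (hinj α) _ (by simp)]
    simp [pderiv_X, Pi.single_apply]
  have hTinr (i s β n) :
      T i s (X (Sum.inr β, n)) = -pderiv (Sum.inl i, s) ((⇑D)^[n] (p β)) := by
    rw [hT, Finset.sum_eq_single β, finsumPderiv_X_self (hinj β), pderiv_X_of_ne (by simp),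
      zero_sub]
    · intro α _ hα
      exact finsumPderiv_X_of_notMem (hinj α) _ (by simp [hα])
    · simp
  have hsucc (i s) : ⁅T i (s + 1), D⁆ = T i s := by
    refine derivation_ext fun ⟨j, n⟩ => ?_
    rw [Derivation.commutator_apply, hD]
    rcases j with j | β
    · simp only [hTinl, add_left_inj, apply_ite D, Derivation.map_one_eq_zero, map_zero, ite_self,
        sub_zero]
    · rw [hTinr, hTinr, hTinr, Function.iterate_succ_apply',
        pderiv_succ_total_derivative D hD, map_neg]
      ring
  have hzero (i) : ⁅T i 0, D⁆ = 0 := by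
    refine derivation_ext fun ⟨j, n⟩ => ?_
    rw [Derivation.commutator_apply, hD]
    rcases j with j | β
    · simp [hTinl, apply_ite D]
    · rw [hTinr, hTinr, Function.iterate_succ_apply', pderiv_zero_total_derivative D hD, map_neg,
        sub_self, Derivation.zero_apply]
  refine ⟨fun i s f => ?_, fun i f => ?_⟩
  · rw [hDtT, hDtT, hDtT, ← Derivation.commutator_apply, hsucc]
  · rw [hDtT, hDtT, ← Derivation.commutator_apply, hzero, Derivation.zero_apply]
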